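/- arXiv:2401.12704 — 16 statements merged into one kernel-verified Lean document; each statement's English description precedes it below -/
import Mathlib

section
/- Let (X,r) be a left non-degenerate solution of the set-theoretic braid equation, with r(a,b) = (σ_a(b), τ_b(a)). Then the binary operation on X defined by a ▷_r b := σ_a(τ_{σ_b^{-1}(a)}(b)) is left self-distributive, i.e. (X, ▷_r) is a left shelf. -/
/-- The map `(r × id)` acting on triples. -/
def braidMapL {X : Type*} (r : X × X → X × X) : X × X × X → X × X × X :=
  fun p => ((r (p.1, p.2.1)).1, (r (p.1, p.2.1)).2, p.2.2)

/-- The map `(id × r)` acting on triples. -/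
def braidMapR {X : Type*} (r : X × X → X × X) : X × X × X → X × X × X :=
  fun p => (p.1, (r (p.2.1, p.2.2)).1, (r (p.2.1, p.2.2)).2)

/-- `r` is a set-theoretic solution of the braid equation. -/
def IsBraidSolution {X : Type*} (r : X × X → X × X) : Prop :=
  braidMapL r ∘ braidMapR r ∘ braidMapL r = braidMapR r ∘ braidMapL r ∘ braidMapR r

/-- If `(X,r)` is a left non-degenerate solution of the braid equation, with
`r(a,b) = (σ_a(b), τ_b(a))`, then `a ▷_r b := σ_a(τ_{σ_b⁻¹(a)}(b))` is left
self-distributive, i.e. `(X, ▷_r)` is a left shelf. -/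
theorem lnd_solution_gives_shelf {X : Type*} (r : X × X → X × X)
    (σ τ σinv : X → X → X)
    (hr : ∀ a b : X, r (a, b) = (σ a b, τ b a))
    (hinv1 : ∀ a b : X, σ a (σinv a b) = b)
    (hinv2 : ∀ a b : X, σinv a (σ a b) = b)
    (hsol : IsBraidSolution r)
    (tri : X → X → X)
    (htri : ∀ a b : X, tri a b = σ a (τ (σinv b a) b)) :
    ∀ a b c : X, tri a (tri b c) = tri (tri a b) (tri a c) := by
  have braid : ∀ a b c : X,
      σ (σ a b) (σ (τ b a) c) = σ a (σ b c) ∧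
      τ (σ (τ b a) c) (σ a b) = σ (τ (σ b c) a) (τ c b) ∧
      τ c (τ b a) = τ (τ c b) (τ (σ b c) a) := by
    intro a b c
    have h := congrFun hsol (a, b, c)
    simpa only [braidMapL, braidMapR, Function.comp_apply, hr, Prod.mk.injEq] using h
  have tri_σ : ∀ b x : X, tri (σ b x) b = σ (σ b x) (τ x b) := by
    intro b x
    rw [htri, hinv2]
  have σ_tri : ∀ a b c : X, σ a (tri b c) = tri (σ a b) (σ a c) := by
    intro a b c
    obtain ⟨x, rfl⟩ : ∃ x, σ c x = b := ⟨_, hinv1 c b⟩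
    rw [tri_σ, ← (braid a c x).1, tri_σ, (braid a c x).2.1, (braid a c x).1,
      (braid a (σ c x) (τ x c)).1]
  intro c b a
  obtain ⟨x, rfl⟩ : ∃ x, σ a x = b := ⟨_, hinv1 a b⟩
  obtain ⟨y, rfl⟩ : ∃ y, σ a (σ x y) = c := ⟨σinv x (σinv a c), by rw [hinv1, hinv1]⟩
  have h_left : tri (σ a (σ x y)) (tri (σ a x) a) =
      σ (σ a x) (σ (σ (τ x a) y) (τ y (τ x a))) := by
    rw [tri_σ a x, ← (braid a x y).1, ← σ_tri, tri_σ]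
  have h_right : tri (tri (σ a (σ x y)) (σ a x)) (tri (σ a (σ x y)) a) =
      σ (σ a (σ x y)) (σ (σ (τ (σ x y) a) (τ y x)) (τ (τ y x) (τ (σ x y) a))) := by
    rw [← σ_tri, tri_σ x y, tri_σ a (σ x y), ← (braid a (σ x y) (τ y x)).1, ← σ_tri, tri_σ]
  rw [h_left, h_right, ← (braid (σ a x) (σ (τ x a) y) (τ y (τ x a))).1,
    (braid a x y).1, (braid a x y).2.1, (braid a x y).2.2]
end

section
/- Let (X,r) be a left non-degenerate solution of the set-theoretic braid equation, with r(a,b) = (σ_a(b), τ_b(a)), and let r' be its derived solution, r'(a,b) = (b, σ_b(τ_{σ_a^{-1}(b)}(a))). Then the map φ: X × X → X × X defined by φ(a,b) = (a, σ_a(b)) is a bijection and satisfies φ ∘ r = r' ∘ φ (equivalently φ ∘ r ∘ φ^{-1} = r'); hence r and r' are Drinfel'd isomorphic. -/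
/-- A left non-degenerate solution `r` is Drinfel'd isomorphic to its derived
solution `r'(a,b) = (b, σ_b(τ_{σ_a⁻¹(b)}(a)))` via `φ(a,b) = (a, σ_a(b))`. -/
theorem lnd_Disomorphic_to_derived {X : Type*} (r : X × X → X × X)
    (σ τ σinv : X → X → X)
    (hr : ∀ a b : X, r (a, b) = (σ a b, τ b a))
    (hinv1 : ∀ a b : X, σ a (σinv a b) = b)
    (hinv2 : ∀ a b : X, σinv a (σ a b) = b)
    (hsol : IsBraidSolution r)
    (r' : X × X → X × X)
    (hr' : ∀ a b : X, r' (a, b) = (b, σ b (τ (σinv a b) a)))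
    (φ : X × X → X × X)
    (hφ : ∀ a b : X, φ (a, b) = (a, σ a b)) :
    Function.Bijective φ ∧ φ ∘ r = r' ∘ φ := by
  refine ⟨Function.bijective_iff_has_inverse.mpr ⟨fun p => (p.1, σinv p.1 p.2), ?_, ?_⟩, ?_⟩
  · rintro ⟨a, b⟩
    simp only [hφ, hinv2]
  · rintro ⟨a, b⟩
    simp only [hφ, hinv1]
  · ext1 ⟨a, b⟩
    simp only [Function.comp_apply, hr, hφ, hr', hinv2]
end

section
/- Let (X,▷) be a left shelf and φ: X → Sym(X), a ↦ φ_a, a family of bijections of X. Define r_φ: X × X → X × X by r_φ(a,b) = (φ_a(b), φ_{φ_a(b)}^{-1}(φ_a(b) ▷ a)). Then r_φ is a solution of the set-theoretic braid equation if and only if φ is a twist, i.e. every φ_a is an automorphism of (X,▷) and φ_a ∘ φ_b = φ_{φ_a(b)} ∘ φ_{φ_{φ_a(b)}^{-1}(φ_a(b) ▷ a)} for all a,b ∈ X. -/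
/-- Let `(X,▷)` be a left shelf and `φ : X → Sym(X)` a family of bijections.
The map `r_φ(a,b) = (φ_a(b), φ_{φ_a(b)}⁻¹(φ_a(b) ▷ a))` is a solution of the
braid equation if and only if `φ` is a twist, i.e. every `φ_a` is a shelf
automorphism and `φ_a ∘ φ_b = φ_{φ_a(b)} ∘ φ_{φ_{φ_a(b)}⁻¹(φ_a(b) ▷ a)}`. -/
theorem solution_iff_twist {X : Type*} (op : X → X → X)
    (hshelf : ∀ a b c : X, op a (op b c) = op (op a b) (op a c))
    (φ : X → X ≃ X)
    (rφ : X × X → X × X)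
    (hrφ : ∀ a b : X, rφ (a, b) = (φ a b, (φ (φ a b)).symm (op (φ a b) a))) :
    IsBraidSolution rφ ↔
      ((∀ a x y : X, φ a (op x y) = op (φ a x) (φ a y)) ∧
       (∀ a b c : X,
          φ a (φ b c) = φ (φ a b) (φ ((φ (φ a b)).symm (op (φ a b) a)) c))) := by
  set t : X → X → X := fun a b => (φ (φ a b)).symm (op (φ a b) a) with ht
  have ht' : ∀ a b, φ (φ a b) (t a b) = op (φ a b) a := by simp [ht]
  have hr : ∀ a b, rφ (a, b) = (φ a b, t a b) := hrφ
  have hsol : IsBraidSolution rφ ↔ ∀ a b c,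
      φ (φ a b) (φ (t a b) c) = φ a (φ b c) ∧
      t (φ a b) (φ (t a b) c) = φ (t a (φ b c)) (t b c) ∧
      t (t a b) c = t (t a (φ b c)) (t b c) := by
    simp only [IsBraidSolution, funext_iff, Prod.forall, Function.comp_apply, braidMapL, braidMapR,
      hr, Prod.mk.injEq]
  change _ ↔ _ ∧ ∀ a b c : X, φ a (φ b c) = φ (φ a b) (φ (t a b) c)
  -- Given the first component, both sides of the second can be compared after `φ (φ a (φ b c))`.
  have hleft : (∀ a b c : X, φ a (φ b c) = φ (φ a b) (φ (t a b) c)) → ∀ a b c,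
      φ (φ a (φ b c)) (t (φ a b) (φ (t a b) c)) = op (φ a (φ b c)) (φ a b) := by
    intro htw a b c
    rw [htw a b c, ht']
  have hright : (∀ a b c : X, φ a (φ b c) = φ (φ a b) (φ (t a b) c)) → ∀ a b c,
      φ (φ a (φ b c)) (φ (t a (φ b c)) (t b c)) = φ a (op (φ b c) b) := by
    intro htw a b c
    rw [← htw a (φ b c), ht']
  rw [hsol]
  constructor
  · intro h
    have htw : ∀ a b c : X, φ a (φ b c) = φ (φ a b) (φ (t a b) c) := fun a b c => (h a b c).1.symm
    refine ⟨fun a x y => ?_, htw⟩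
    obtain ⟨c, rfl⟩ := (φ y).surjective x
    rw [← hright htw, ← (h a y c).2.1, hleft htw]
  · rintro ⟨haut, htw⟩ a b c
    have hsnd : t (φ a b) (φ (t a b) c) = φ (t a (φ b c)) (t b c) := by
      apply (φ (φ a (φ b c))).injective
      rw [hleft htw, hright htw, haut]
    refine ⟨(htw a b c).symm, hsnd, ?_⟩
    apply (φ (φ (t a b) c)).injective
    apply (φ (φ a b)).injective
    rw [ht', haut, ← htw a b c, ht', htw (φ a b) (φ (t a b) c), ← htw a b c, hsnd, ht', haut,
      hright htw, ht', haut, hshelf]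
end

section
/- Let (X,r) be a left non-degenerate solution of the set-theoretic braid equation, with r(a,b) = (σ_a(b), τ_b(a)), and let ▷_r be the associated shelf operation a ▷_r b := σ_a(τ_{σ_b^{-1}(a)}(b)). Then each σ_a is an automorphism of (X, ▷_r), i.e. σ_a(b ▷_r c) = σ_a(b) ▷_r σ_a(c) for all a,b,c ∈ X. -/
/-- For a left non-degenerate solution `(X,r)`, each `σ_a` is an automorphism
of the associated shelf `(X, ▷_r)`, where `a ▷_r b := σ_a(τ_{σ_b⁻¹(a)}(b))`. -/
theorem sigma_is_shelf_automorphism {X : Type*} (r : X × X → X × X)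
    (σ τ σinv : X → X → X)
    (hr : ∀ a b : X, r (a, b) = (σ a b, τ b a))
    (hinv1 : ∀ a b : X, σ a (σinv a b) = b)
    (hinv2 : ∀ a b : X, σinv a (σ a b) = b)
    (hsol : IsBraidSolution r)
    (tri : X → X → X)
    (htri : ∀ a b : X, tri a b = σ a (τ (σinv b a) b)) :
    ∀ a b c : X, σ a (tri b c) = tri (σ a b) (σ a c) := by
  have hbraid := fun a b c => congrFun hsol (a, b, c)
  simp only [Function.comp_apply, braidMapL, braidMapR, hr, Prod.mk.injEq] at hbraid
  have hσ (a b c : X) : σ (σ a b) (σ (τ b a) c) = σ a (σ b c) := (hbraid a b c).1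
  have hτ (a b c : X) : τ (σ (τ b a) c) (σ a b) = σ (τ (σ b c) a) (τ c b) :=
    (hbraid a b c).2.1
  intro a b c
  obtain ⟨x, rfl⟩ : ∃ x, σ c x = b := ⟨σinv c b, hinv1 c b⟩
  rw [htri, htri, hinv2, ← hσ a c x, hinv2, hτ, hσ a c x, hσ]
end

section
/- A left non-degenerate solution (X,r) of the set-theoretic braid equation, with r(a,b) = (σ_a(b), τ_b(a)), is bijective as a map X × X → X × X if and only if the associated left shelf (X, ▷_r), where a ▷_r b := σ_a(τ_{σ_b^{-1}(a)}(b)), is a left rack, i.e. for each a ∈ X the map b ↦ a ▷_r b is a bijection of X. -/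
/-- A fibre-preserving self-map of a product is bijective iff it is bijective on each fibre. -/
theorem bijective_prodMk_fst_iff {α β : Type*} (f : α → β → β) :
    Function.Bijective (fun p : α × β => (p.1, f p.1 p.2)) ↔
      ∀ a, Function.Bijective (fun b => f a b) := by
  constructor
  · rintro ⟨hi, hs⟩ a
    refine ⟨fun b c h => ?_, fun c => ?_⟩
    · exact congrArg Prod.snd (@hi (a, b) (a, c) (Prod.ext rfl h))
    · obtain ⟨⟨x, b⟩, h⟩ := hs (a, c)
      obtain ⟨rfl, hb⟩ := Prod.mk.inj h
      exact ⟨b, hb⟩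
  · intro h
    refine ⟨?_, ?_⟩
    · rintro ⟨a, b⟩ ⟨c, d⟩ e
      obtain ⟨rfl, hbd⟩ := Prod.mk.inj e
      exact Prod.ext rfl ((h a).1 hbd)
    · rintro ⟨a, c⟩
      obtain ⟨b, hb⟩ := (h a).2 c
      exact ⟨(a, b), Prod.ext rfl hb⟩

/-- A left non-degenerate solution `(X,r)` is bijective if and only if the
associated left shelf `(X, ▷_r)`, `a ▷_r b := σ_a(τ_{σ_b⁻¹(a)}(b))`, is a left
rack, i.e. each map `b ↦ a ▷_r b` is a bijection of `X`. -/
theorem bijective_iff_rack {X : Type*} (r : X × X → X × X)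
    (σ τ σinv : X → X → X)
    (hr : ∀ a b : X, r (a, b) = (σ a b, τ b a))
    (hinv1 : ∀ a b : X, σ a (σinv a b) = b)
    (hinv2 : ∀ a b : X, σinv a (σ a b) = b)
    (hsol : IsBraidSolution r)
    (tri : X → X → X)
    (htri : ∀ a b : X, tri a b = σ a (τ (σinv b a) b)) :
    Function.Bijective r ↔ ∀ a : X, Function.Bijective (fun b : X => tri a b) := by
  let e : X × X ≃ X × X :=
    { toFun := fun p => (p.2, σinv p.2 p.1)
      invFun := fun p => (σ p.1 p.2, p.1)
      left_inv := fun p => Prod.ext (hinv1 _ _) rfl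
      right_inv := fun p => Prod.ext rfl (hinv2 _ _) }
  let g : X × X ≃ X × X :=
    { toFun := fun p => (p.1, σ p.1 p.2)
      invFun := fun p => (p.1, σinv p.1 p.2)
      left_inv := fun p => Prod.ext rfl (hinv2 _ _)
      right_inv := fun p => Prod.ext rfl (hinv1 _ _) }
  have conj : (fun p : X × X => (p.1, tri p.1 p.2)) = g ∘ r ∘ e := by
    funext p
    simp [e, g, hr, htri, hinv1]
  rw [← bijective_prodMk_fst_iff tri, conj, g.comp_bijective, e.bijective_comp]
end

section
/- Let X be a set and φ_a: X → X a bijection for each a ∈ X. The map r: X × X → X × X defined by r(a,b) = (φ_a(b), φ_{φ_a(b)}^{-1}(a)) is always involutive (r ∘ r = id) and left non-degenerate, and r is a solution of the set-theoretic braid equation if and only if φ_a ∘ φ_b = φ_{φ_a(b)} ∘ φ_{φ_{φ_a(b)}^{-1}(a)} for all a,b ∈ X. Moreover, every left non-degenerate involutive solution (X,r), r(a,b) = (σ_a(b), τ_b(a)), is of this form with φ_a = σ_a, i.e. satisfies τ_b(a) = σ_{σ_a(b)}^{-1}(a). -/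
section

variable {X : Type*} {φ : X → X ≃ X} {r : X × X → X × X}

/-- The condition `φ_a ∘ φ_b = φ_{φ_a(b)} ∘ φ_{φ_{φ_a(b)}⁻¹(a)}` is the first component of the
braid equation. -/
theorem IsBraidSolution.apply_apply
    (hr : ∀ a b : X, r (a, b) = (φ a b, (φ (φ a b)).symm a))
    (h : IsBraidSolution r) (a b c : X) :
    φ a (φ b c) = φ (φ a b) (φ ((φ (φ a b)).symm a) c) := by
  have := congrArg Prod.fst (congrFun h (a, b, c))
  simpa [braidMapL, braidMapR, hr] using this.symm

theorem isBraidSolution_of_apply_apply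
    (hr : ∀ a b : X, r (a, b) = (φ a b, (φ (φ a b)).symm a))
    (h : ∀ a b c : X, φ a (φ b c) = φ (φ a b) (φ ((φ (φ a b)).symm a) c)) :
    IsBraidSolution r := by
  funext ⟨a, b, c⟩
  simp only [Function.comp_apply, braidMapL, braidMapR, hr, Prod.mk.injEq]
  have second : φ ((φ (φ a (φ b c))).symm a) ((φ (φ b c)).symm b) =
      (φ (φ a (φ b c))).symm (φ a b) := by
    rw [Equiv.eq_symm_apply, ← h a (φ b c), Equiv.apply_symm_apply]
  refine ⟨(h a b c).symm, ?_, ?_⟩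
  · rw [second, ← h a b c]
  · rw [second, Equiv.eq_symm_apply, Equiv.eq_symm_apply]
    have third := h (φ a b) (φ ((φ (φ a b)).symm a) c)
      ((φ (φ ((φ (φ a b)).symm a) c)).symm ((φ (φ a b)).symm a))
    rw [← h a b c, Equiv.apply_symm_apply, Equiv.apply_symm_apply] at third
    exact third.symm

end

/-- The map `r(a,b) = (φ_a(b), φ_{φ_a(b)}⁻¹(a))` is always involutive and left
non-degenerate, and is a solution of the braid equation iff
`φ_a ∘ φ_b = φ_{φ_a(b)} ∘ φ_{φ_{φ_a(b)}⁻¹(a)}` for all `a,b`.  Moreover, every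
left non-degenerate involutive solution `s(a,b) = (σ_a(b), τ_b(a))` is of this
form with `φ_a = σ_a`, i.e. `τ_b(a) = σ_{σ_a(b)}⁻¹(a)`. -/
theorem involutive_solutions_characterisation {X : Type*} (φ : X → X ≃ X)
    (r : X × X → X × X)
    (hr : ∀ a b : X, r (a, b) = (φ a b, (φ (φ a b)).symm a))
    (s : X × X → X × X) (σ τ σinv : X → X → X)
    (hs : ∀ a b : X, s (a, b) = (σ a b, τ b a))
    (hinv1 : ∀ a b : X, σ a (σinv a b) = b)
    (hinv2 : ∀ a b : X, σinv a (σ a b) = b)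
    (hsinvol : s ∘ s = id)
    (hssol : IsBraidSolution s) :
    (r ∘ r = id) ∧
    (∀ a : X, Function.Bijective (fun b : X => (r (a, b)).1)) ∧
    (IsBraidSolution r ↔
      ∀ a b c : X, φ a (φ b c) = φ (φ a b) (φ ((φ (φ a b)).symm a) c)) ∧
    (∀ a b : X, τ b a = σinv (σ a b) a) := by
  refine ⟨?_, fun a => ?_, ⟨fun h => h.apply_apply hr, isBraidSolution_of_apply_apply hr⟩,
    fun a b => ?_⟩
  · funext ⟨a, b⟩
    simp [hr]
  · simpa only [hr] using (φ a).bijective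
  · have h := congrArg Prod.fst (congrFun hsinvol (a, b))
    simp only [Function.comp_apply, hs, id] at h
    rw [← hinv2 (σ a b) (τ b a), h]
end

section
/- Let (X,▷) and (Y,▶) be left shelves with twists φ: X → Aut(X,▷) and ψ: Y → Aut(Y,▶), and let f: X → Y be a shelf homomorphism (f(a▷b) = f(a)▶f(b)). Define Φ: X × X → Y × Y by Φ(a,b) = (f(a), ψ_{f(a)}^{-1}(f(φ_a(b)))). Then Φ ∘ r_φ = r_ψ ∘ Φ, where r_φ(a,b) = (φ_a(b), φ_{φ_a(b)}^{-1}(φ_a(b) ▷ a)) and r_ψ(u,v) = (ψ_u(v), ψ_{ψ_u(v)}^{-1}(ψ_u(v) ▶ u)). Moreover, f is bijective if and only if Φ is bijective. -/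
/-- Two homomorphic shelves with twists have D-homomorphic solutions: with
`Φ(a,b) = (f(a), ψ_{f(a)}⁻¹(f(φ_a(b))))` one has `Φ ∘ r_φ = r_ψ ∘ Φ`, and `f`
is bijective if and only if `Φ` is bijective. -/
theorem twist_homomorphism_D_homomorphism {X Y : Type*}
    (opX : X → X → X) (opY : Y → Y → Y)
    (hX : ∀ a b c : X, opX a (opX b c) = opX (opX a b) (opX a c))
    (hY : ∀ a b c : Y, opY a (opY b c) = opY (opY a b) (opY a c))
    (φ : X → X ≃ X) (ψ : Y → Y ≃ Y)
    (hφaut : ∀ a x y : X, φ a (opX x y) = opX (φ a x) (φ a y))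
    (hφtw : ∀ a b c : X,
      φ a (φ b c) = φ (φ a b) (φ ((φ (φ a b)).symm (opX (φ a b) a)) c))
    (hψaut : ∀ u v w : Y, ψ u (opY v w) = opY (ψ u v) (ψ u w))
    (hψtw : ∀ u v w : Y,
      ψ u (ψ v w) = ψ (ψ u v) (ψ ((ψ (ψ u v)).symm (opY (ψ u v) u)) w))
    (f : X → Y)
    (hf : ∀ a b : X, f (opX a b) = opY (f a) (f b))
    (Φ : X × X → Y × Y)
    (hΦ : ∀ a b : X, Φ (a, b) = (f a, (ψ (f a)).symm (f (φ a b))))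
    (rφ : X × X → X × X)
    (hrφ : ∀ a b : X, rφ (a, b) = (φ a b, (φ (φ a b)).symm (opX (φ a b) a)))
    (rψ : Y × Y → Y × Y)
    (hrψ : ∀ u v : Y, rψ (u, v) = (ψ u v, (ψ (ψ u v)).symm (opY (ψ u v) u))) :
    Φ ∘ rφ = rψ ∘ Φ ∧ (Function.Bijective f ↔ Function.Bijective Φ) := by
  refine ⟨?_, fun h => ⟨?_, ?_⟩, fun h => ⟨?_, ?_⟩⟩
  · funext ⟨a, b⟩
    simp [hΦ, hrφ, hrψ, hf]
  · rintro ⟨a, b⟩ ⟨c, d⟩ hab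
    rw [hΦ, hΦ, Prod.mk.injEq] at hab
    obtain ⟨hac, hbd⟩ := hab
    obtain rfl := h.injective hac
    rw [(φ a).injective (h.injective ((ψ (f a)).symm.injective hbd))]
  · rintro ⟨u, v⟩
    obtain ⟨a, rfl⟩ := h.surjective u
    obtain ⟨c, hc⟩ := h.surjective (ψ (f a) v)
    exact ⟨(a, (φ a).symm c), by simp [hΦ, hc]⟩
  · intro a b hab
    have key : Φ (a, (φ a).symm a) = Φ (b, (φ b).symm b) := by simp [hΦ, hab]
    exact congrArg Prod.fst (h.injective key)
  · intro v
    obtain ⟨⟨a, b⟩, hab⟩ := h.surjective (v, v)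
    rw [hΦ] at hab
    exact ⟨a, congrArg Prod.fst hab⟩
end

section
/- Let (X,r) be a left non-degenerate solution of the set-theoretic braid equation, with r(a,b) = (σ_a(b), τ_b(a)), let ▷ denote the associated shelf operation a ▷ b := σ_a(τ_{σ_b^{-1}(a)}(b)), and fix x ∈ X. Define a • b := σ_a(b) ▷ (a ▷ x). Then σ_a(b) • τ_b(a) = a • b for all a,b ∈ X; that is, (X,•) is a Yang-Baxter algebra for r. -/
/-- The three componentwise identities equivalent to the braid equation. -/
theorem IsBraidSolution.components {X : Type*} {r : X × X → X × X} {σ τ : X → X → X}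
    (hr : ∀ a b : X, r (a, b) = (σ a b, τ b a)) (hsol : IsBraidSolution r) (a b c : X) :
    σ (σ a b) (σ (τ b a) c) = σ a (σ b c) ∧
      τ (σ (τ b a) c) (σ a b) = σ (τ (σ b c) a) (τ c b) ∧
      τ c (τ b a) = τ (τ c b) (τ (σ b c) a) := by
  simpa [braidMapL, braidMapR, hr] using congrFun hsol (a, b, c)

section Shelf

variable {X : Type*} {r : X × X → X × X} {σ τ σinv tri : X → X → X}

/-- The shelf operation evaluated on the first component of `r (b, c)`. -/
theorem tri_sigma_left (hinv2 : ∀ a b : X, σinv a (σ a b) = b)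
    (htri : ∀ a b : X, tri a b = σ a (τ (σinv b a) b)) (b c : X) :
    tri (σ b c) b = σ (σ b c) (τ c b) := by
  rw [htri, hinv2]

/-- Each `σ a` is an endomorphism of the associated shelf. -/
theorem sigma_tri (hr : ∀ a b : X, r (a, b) = (σ a b, τ b a))
    (hinv1 : ∀ a b : X, σ a (σinv a b) = b) (hinv2 : ∀ a b : X, σinv a (σ a b) = b)
    (hsol : IsBraidSolution r) (htri : ∀ a b : X, tri a b = σ a (τ (σinv b a) b))
    (a d b : X) : σ a (tri d b) = tri (σ a d) (σ a b) := by
  obtain ⟨c, rfl⟩ : ∃ c, σ b c = d := ⟨_, hinv1 b d⟩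
  obtain ⟨h1, h2, -⟩ := hsol.components hr a b c
  rw [← h1, tri_sigma_left hinv2 htri, tri_sigma_left hinv2 htri, h1, h2,
    (hsol.components hr a (σ b c) (τ c b)).1]

/-- The operation associated with a left non-degenerate solution is left self-distributive. -/
theorem tri_self_distrib (hr : ∀ a b : X, r (a, b) = (σ a b, τ b a))
    (hinv1 : ∀ a b : X, σ a (σinv a b) = b) (hinv2 : ∀ a b : X, σinv a (σ a b) = b)
    (hsol : IsBraidSolution r) (htri : ∀ a b : X, tri a b = σ a (τ (σinv b a) b))
    (w u a : X) : tri w (tri u a) = tri (tri w u) (tri w a) := by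
  have htl := tri_sigma_left hinv2 htri
  have hσ := sigma_tri hr hinv1 hinv2 hsol htri
  obtain ⟨b, rfl⟩ : ∃ b, σ a b = u := ⟨_, hinv1 a u⟩
  obtain ⟨d, rfl⟩ : ∃ d, σ a d = w := ⟨_, hinv1 a w⟩
  obtain ⟨c, rfl⟩ : ∃ c, σ b c = d := ⟨_, hinv1 b d⟩
  obtain ⟨h1, h2, h3⟩ := hsol.components hr a b c
  have hleft : tri (σ a (σ b c)) (tri (σ a b) a) =
      σ (σ a b) (σ (σ (τ b a) c) (τ c (τ b a))) := by
    rw [← h1, htl a b, ← hσ, htl]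
  have hright : tri (tri (σ a (σ b c)) (σ a b)) (tri (σ a (σ b c)) a) =
      σ (σ a (σ b c)) (σ (σ (τ (σ b c) a) (τ c b)) (τ c (τ b a))) := by
    rw [← hσ a, htl b c, htl a, ← (hsol.components hr a (σ b c) (τ c b)).1, ← hσ, htl, ← h3]
  rw [hleft, hright, ← (hsol.components hr (σ a b) (σ (τ b a) c) _).1, h1, h2]

end Shelf

/-- For a left non-degenerate solution `(X,r)` with associated shelf operation
`a ▷ b := σ_a(τ_{σ_b⁻¹(a)}(b))` and a fixed `x ∈ X`, the operation
`a • b := σ_a(b) ▷ (a ▷ x)` satisfies `σ_a(b) • τ_b(a) = a • b`, i.e. `(X,•)`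
is a Yang-Baxter algebra for `r`. -/
theorem yang_baxter_algebra_exists {X : Type*} (r : X × X → X × X)
    (σ τ σinv : X → X → X)
    (hr : ∀ a b : X, r (a, b) = (σ a b, τ b a))
    (hinv1 : ∀ a b : X, σ a (σinv a b) = b)
    (hinv2 : ∀ a b : X, σinv a (σ a b) = b)
    (hsol : IsBraidSolution r)
    (tri : X → X → X)
    (htri : ∀ a b : X, tri a b = σ a (τ (σinv b a) b))
    (x : X)
    (bull : X → X → X)
    (hbull : ∀ a b : X, bull a b = tri (σ a b) (tri a x)) :
    ∀ a b : X, bull (σ a b) (τ b a) = bull a b := by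
  intro a b
  rw [hbull, hbull, ← tri_sigma_left hinv2 htri,
    ← tri_self_distrib hr hinv1 hinv2 hsol htri]
end

section
/- Let (X,+) be a (not necessarily abelian) group and f: X → X a bijection with f(0) = 0. Define a ▷ b := a + f(b) − f(a). Then (X,▷) is a quandle (i.e. ▷ is left self-distributive, a▷a = a for all a, and each map b ↦ a▷b is a bijection of X) if and only if f is a metahomomorphism of (X,+). -/
/-- For a bijection `f` of a (not necessarily abelian) group `(X,+)` with
`f(0) = 0`, the operation `a ▷ b := a + f(b) − f(a)` makes `(X,▷)` a quandle
if and only if `f` is a metahomomorphism of `(X,+)`. -/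
theorem quandle_iff_metahomomorphism {X : Type*} [AddGroup X]
    (f : X → X) (hf : Function.Bijective f) (hf0 : f 0 = 0)
    (tri : X → X → X)
    (htri : ∀ a b : X, tri a b = a + f b - f a) :
    ((∀ a b c : X, tri a (tri b c) = tri (tri a b) (tri a c)) ∧
     (∀ a : X, tri a a = a) ∧
     (∀ a : X, Function.Bijective (fun b : X => tri a b))) ↔
      (∀ a b : X, f (a + b - f a) = f a + f b - f (f a)) := by
  simp only [htri]
  constructor
  · rintro ⟨h, -, -⟩ a c
    have key : ∀ c, f (a + c - f a) = f a + f c - f a + f (a - f a) := by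
      intro c
      obtain ⟨c, rfl⟩ := hf.surjective c
      have h₁ := h a 0 c
      simp only [hf0, zero_add, sub_zero, add_zero] at h₁
      rw [add_sub_assoc, sub_eq_add_neg a, add_sub_assoc, add_assoc, add_left_cancel_iff] at h₁
      rw [sub_eq_add_neg (f a + _), add_assoc (f a), ← sub_eq_add_neg, h₁]
      simp [sub_eq_add_neg, add_assoc]
    have h₀ : f (a - f a) = f a - f (f a) := by
      have h₂ := key (f a)
      rw [add_sub_cancel_right] at h₂
      rw [← neg_add_eq_iff_eq_add] at h₂
      rw [← h₂]
      simp [sub_eq_add_neg, add_assoc]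
    rw [key, h₀]
    simp [sub_eq_add_neg, add_assoc]
  · intro h
    refine ⟨fun a b c => ?_, fun a => add_sub_cancel_right a (f a), fun a => ?_⟩
    · rw [h, h, h]
      simp [sub_eq_add_neg, add_assoc]
    · exact ((Equiv.subRight (f a)).bijective.comp (Equiv.addLeft a).bijective).comp hf
end

section
/- Let (X,+) be a (not necessarily abelian) group and f: X → X a heap endomorphism. Define a ▷_t b := f(b) − f(a) + a and a •_t b := −f(f(a)) + f(a) − f(b) + b. Then a •_t b = b •_t (b ▷_t a) for all a,b ∈ X; that is, (X,•_t) is a Yang-Baxter algebra for the derived solution r(a,b) = (b, b ▷_t a). -/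
/-- For a heap endomorphism `f` of a group `(X,+)`, with
`a ▷_t b := f(b) − f(a) + a` and `a •_t b := −f(f(a)) + f(a) − f(b) + b`,
one has `a •_t b = b •_t (b ▷_t a)`, i.e. `(X,•_t)` is a Yang-Baxter algebra
for the derived solution `r(a,b) = (b, b ▷_t a)`. -/
theorem yang_baxter_algebra_t {X : Type*} [AddGroup X]
    (f : X → X)
    (hf : ∀ a b c : X, f (a - b + c) = f a - f b + f c)
    (tri bull : X → X → X)
    (htri : ∀ a b : X, tri a b = f b - f a + a)
    (hbull : ∀ a b : X, bull a b = -f (f a) + f a - f b + b) :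
    ∀ a b : X, bull a b = bull b (tri b a) := by
  intro a b
  rw [hbull, hbull, htri, hf]
  simp [sub_eq_add_neg, add_assoc]
end

section
/- Let (X,+) be a (not necessarily abelian) group and f: X → X a bijective heap endomorphism, and define a • b := f(a) + b. Then (X,+,•) is a left invertible right pre-Lie skew brace: (i) a•(b+c) = a•b − a•0 + a•c and (a+b)•c = a•c − 0•c + b•c for all a,b,c; (ii) (a•b)•c − a•(b•c) = (a•c)•b − a•(c•b) for all a,b,c (where x − y := x + (−y)); (iii) e := f^{-1}(0) satisfies e•b = b for all b, and for every b ∈ X the element f^{-1}(e − b) is the unique x ∈ X with x•b = e. -/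
/-- For a bijective heap endomorphism `f` of a group `(X,+)` and
`a • b := f(a) + b`, the triple `(X,+,•)` is a left invertible right pre-Lie
skew brace. -/
theorem pre_lie_skew_brace_s {X : Type*} [AddGroup X]
    (f : X ≃ X)
    (hf : ∀ a b c : X, f (a - b + c) = f a - f b + f c)
    (bull : X → X → X)
    (hbull : ∀ a b : X, bull a b = f a + b) :
    (∀ a b c : X, bull a (b + c) = bull a b - bull a 0 + bull a c) ∧
    (∀ a b c : X, bull (a + b) c = bull a c - bull 0 c + bull b c) ∧
    (∀ a b c : X,
      bull (bull a b) c - bull a (bull b c) =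
        bull (bull a c) b - bull a (bull c b)) ∧
    (∀ b : X, bull (f.symm 0) b = b) ∧
    (∀ b : X, bull (f.symm (f.symm 0 - b)) b = f.symm 0 ∧
      ∀ x : X, bull x b = f.symm 0 → x = f.symm (f.symm 0 - b)) := by
  have hadd (a b : X) : f (a + b) = f a - f 0 + f b := by
    simpa using hf a 0 b
  refine ⟨?_, ?_, ?_, ?_, ?_⟩
  · intro a b c
    simp [hbull, sub_eq_add_neg, add_assoc]
  · intro a b c
    simp [hbull, hadd, sub_eq_add_neg, add_assoc]
  · intro a b c
    simp [hbull, hadd, sub_eq_add_neg, add_assoc]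
  · intro b
    simp [hbull]
  · intro b
    refine ⟨by simp [hbull], fun x hx => ?_⟩
    rw [hbull] at hx
    rw [Equiv.eq_symm_apply, ← hx, add_sub_cancel_right]
end

section
/- Let (X,+) be a (not necessarily abelian) group, f: X → X a bijective heap endomorphism, and h ∈ X. Define a · b := h + f(a) + b. Then (X,+,·) is a left invertible right pre-Lie skew brace: (i) a·(b+c) = a·b − a·0 + a·c and (a+b)·c = a·c − 0·c + b·c for all a,b,c; (ii) (a·b)·c − a·(b·c) = (a·c)·b − a·(c·b) for all a,b,c (where x − y := x + (−y)); (iii) e := f^{-1}(−h) satisfies e·b = b for all b, and for every b ∈ X the element f^{-1}(−h + e − b) is the unique x ∈ X with x·b = e. -/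
/-- For a bijective heap endomorphism `f` of a group `(X,+)`, `h ∈ X`, and
`a · b := h + f(a) + b`, the triple `(X,+,·)` is a left invertible right
pre-Lie skew brace, with left identity `e = f⁻¹(−h)` and left inverse of `b`
given by `f⁻¹(−h + e − b)`. -/
theorem pre_lie_skew_brace_shifted {X : Type*} [AddGroup X]
    (f : X ≃ X)
    (hf : ∀ a b c : X, f (a - b + c) = f a - f b + f c)
    (h : X)
    (dot : X → X → X)
    (hdot : ∀ a b : X, dot a b = h + f a + b) :
    (∀ a b c : X, dot a (b + c) = dot a b - dot a 0 + dot a c) ∧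
    (∀ a b c : X, dot (a + b) c = dot a c - dot 0 c + dot b c) ∧
    (∀ a b c : X,
      dot (dot a b) c - dot a (dot b c) =
        dot (dot a c) b - dot a (dot c b)) ∧
    (∀ b : X, dot (f.symm (-h)) b = b) ∧
    (∀ b : X, dot (f.symm (-h + f.symm (-h) - b)) b = f.symm (-h) ∧
      ∀ x : X, dot x b = f.symm (-h) → x = f.symm (-h + f.symm (-h) - b)) := by
  have hadd (a b : X) : f (a + b) = f a - f 0 + f b := by
    simpa using hf a 0 b
  -- The associator of `a`, `b`, `c` depends only on `a`.
  have hassoc (a b c : X) :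
      dot (dot a b) c - dot a (dot b c) = h + f (h + f a) - f 0 - h - f a - h := by
    rw [hdot (dot a b), hdot a b, hadd (h + f a) b]
    simp only [hdot, sub_eq_add_neg, neg_add_rev, add_assoc,
      add_neg_cancel_left]
  refine ⟨fun a b c => ?_, fun a b c => ?_, fun a b c => ?_, fun b => ?_,
    fun b => ⟨?_, fun x hx => ?_⟩⟩
  · simp [hdot, sub_eq_add_neg, add_assoc]
  · simp [hdot, hadd a b, sub_eq_add_neg, add_assoc]
  · rw [hassoc, hassoc]
  · simp [hdot]
  · simp [hdot, sub_eq_add_neg, add_assoc]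
  · rw [f.eq_symm_apply, ← hx, hdot]
    simp [sub_eq_add_neg, add_assoc]
end

section
/- Let (X,+,∘) be a skew brace and let z, z₁ ∈ X be fixed elements. Define b ▷ a := z₁ − b∘z + a∘z − z₁ + b. Then (X,▷) is a quandle: ▷ is left self-distributive (c▷(b▷a) = (c▷b)▷(c▷a)), a ▷ a = a for all a ∈ X, and for each b ∈ X the map a ↦ b ▷ a is a bijection of X. -/
/-- An additive endomorphism `f` of a group makes `b ▷ a := -f b + f a + b` left
self-distributive. -/
theorem AddMonoidHom.neg_add_add_self_distrib {X : Type*} [AddGroup X] (f : X →+ X) (a b c : X) :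
    -f c + f (-f b + f a + b) + c =
      -f (-f c + f b + c) + f (-f c + f a + c) + (-f c + f b + c) := by
  simp only [map_add, map_neg, neg_add_rev, neg_neg, add_assoc, add_neg_cancel_left]

/-- Let `(X,+,∘)` be a skew brace (the `∘`-group structure is given by `circ`,
`cinv`, with identity coinciding with `0`) and `z, z₁ ∈ X`.  Then
`b ▷ a := z₁ − b∘z + a∘z − z₁ + b` makes `(X,▷)` a quandle. -/
theorem skew_brace_parametric_quandle {X : Type*} [AddGroup X]
    (circ : X → X → X) (cinv : X → X)
    (hassoc : ∀ a b c : X, circ (circ a b) c = circ a (circ b c))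
    (hzero_left : ∀ a : X, circ 0 a = a)
    (hzero_right : ∀ a : X, circ a 0 = a)
    (hcinv_left : ∀ a : X, circ (cinv a) a = 0)
    (hcinv_right : ∀ a : X, circ a (cinv a) = 0)
    (hdist_left : ∀ a b c : X, circ a (b + c) = circ a b - a + circ a c)
    (hdist_right : ∀ a b c : X, circ (b + c) a = circ b a - a + circ c a)
    (z z₁ : X)
    (tri : X → X → X)
    (htri : ∀ b a : X, tri b a = z₁ - circ b z + circ a z - z₁ + b) :
    (∀ a b c : X, tri c (tri b a) = tri (tri c b) (tri c a)) ∧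
    (∀ a : X, tri a a = a) ∧
    (∀ b : X, Function.Bijective (fun a : X => tri b a)) := by
  let f : X →+ X := AddMonoidHom.mk' (fun x => (z₁ - z) + (circ x z - z) - (z₁ - z)) (by
    intro x y
    simp only [hdist_right]
    simp only [sub_eq_add_neg, neg_add_rev, neg_neg, add_assoc, neg_add_cancel_left])
  have hf : ∀ b a : X, tri b a = -f b + f a + b := by
    intro b a
    simp only [htri, f, AddMonoidHom.mk'_apply]
    simp only [sub_eq_add_neg, neg_add_rev, neg_neg, add_assoc, neg_add_cancel_left,
      add_neg_cancel_left]
  refine ⟨fun a b c => ?_, fun a => ?_, fun b => ?_⟩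
  · simp only [hf]
    exact f.neg_add_add_self_distrib a b c
  · simp [hf]
  · constructor
    · intro a a' h
      simp only [htri, sub_eq_add_neg, add_left_inj, add_right_inj] at h
      have h' := congrArg (fun x => circ x (cinv z)) h
      simpa only [hassoc, hcinv_right, hzero_right] using h'
    · intro y
      refine ⟨circ (circ b z - z₁ + y - b + z₁) (cinv z), ?_⟩
      simp only [htri, hassoc, hcinv_left, hzero_right]
      simp only [sub_eq_add_neg, add_assoc, neg_add_cancel_left, add_neg_cancel_left,
        neg_add_cancel, add_zero]
end

section
/- Let (X,∘) be a (not necessarily abelian) group and let σ_x, τ_x, f_x, g_x, f̂_x, ĝ_x: X → X (x ∈ X) be families of maps satisfying, for all x,y,w ∈ X: (1) σ_x(y) ∘ τ_y(x) = x ∘ y; (2) σ_x(σ_y(w)) = f_{x∘y}(w) and τ_{σ_y(w)}(x) ∘ τ_w(y) = g_w(x ∘ y); (3) σ_x(y) ∘ σ_{τ_y(x)}(w) = f̂_x(y ∘ w) and τ_w(τ_y(x)) = ĝ_{y∘w}(x). Then the map r: X × X → X × X defined by r(x,y) = (σ_x(y), τ_y(x)) satisfies the set-theoretic braid equation. -/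
/-- If `r(x,y) = (σ_x(y), τ_y(x))` is a `ξ,ζ`-deformed braiding operator on a
group `(X,∘)` (conditions (1)–(3)), then `r` satisfies the set-theoretic braid
equation. -/
theorem deformed_braiding_is_solution {X : Type*} [Group X]
    (σ τ f g fh gh : X → X → X)
    (h1 : ∀ x y : X, σ x y * τ y x = x * y)
    (h2a : ∀ x y w : X, σ x (σ y w) = f (x * y) w)
    (h2b : ∀ x y w : X, τ (σ y w) x * τ w y = g w (x * y))
    (h3a : ∀ x y w : X, σ x y * σ (τ y x) w = fh x (y * w))
    (h3b : ∀ x y w : X, τ w (τ y x) = gh (y * w) x) :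
    IsBraidSolution (fun p : X × X => (σ p.1 p.2, τ p.2 p.1)) := by
  have hfst (x y z : X) : σ (σ x y) (σ (τ y x) z) = σ x (σ y z) := by
    rw [h2a, h1, ← h2a]
  have hthd (x y z : X) : τ z (τ y x) = τ (τ z y) (τ (σ y z) x) := by
    rw [h3b, h3b, h1]
  have hsnd (x y z : X) : τ (σ (τ y x) z) (σ x y) = σ (τ (σ y z) x) (τ z y) := by
    apply mul_left_cancel (a := σ x (σ y z))
    rw [h3a, h1, ← hfst, h1, h3a]
  funext ⟨x, y, z⟩
  simp only [Function.comp_apply, braidMapL, braidMapR, hfst, hsnd, ← hthd]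
end

section
/- Let M be a monoid, X a set, ▷ a binary operation on X, q: X → M a map whose values are invertible elements of M, and h: X → M an injective map, such that for all a,b ∈ X: q_a q_b = q_b q_{b▷a} and q_b h_{b▷a} = h_a q_b. Then (i) ▷ is left self-distributive: c▷(b▷a) = (c▷b)▷(c▷a) for all a,b,c ∈ X, and (ii) for each c ∈ X the map a ↦ c▷a is injective. If moreover there is a binary operation • on X which is left cancellative (a•b = a•c implies b = c) and satisfies a•b = b•(b▷a) for all a,b ∈ X, then a▷a = a for all a ∈ X. -/
/-- From the rack algebra relations (in any monoid `M`): `q : X → M` with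
invertible values, `h : X → M` injective, `q_a q_b = q_b q_{b▷a}` and
`q_b h_{b▷a} = h_a q_b`, one deduces that `▷` is left self-distributive and
each map `a ↦ c▷a` is injective; moreover, if there is a left cancellative
operation `•` on `X` with `a•b = b•(b▷a)`, then `a▷a = a` for all `a`. -/
theorem rack_algebra_gives_rack {M X : Type*} [Monoid M]
    (op : X → X → X) (q h : X → M)
    (hq : ∀ a : X, IsUnit (q a))
    (hinj : Function.Injective h)
    (rel1 : ∀ a b : X, q a * q b = q b * q (op b a))
    (rel2 : ∀ a b : X, q b * h (op b a) = h a * q b) :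
    (∀ a b c : X, op c (op b a) = op (op c b) (op c a)) ∧
    (∀ c : X, Function.Injective (fun a : X => op c a)) ∧
    (∀ m : X → X → X,
      (∀ a b c : X, m a b = m a c → b = c) →
      (∀ a b : X, m a b = m b (op b a)) →
      ∀ a : X, op a a = a) := by
  refine ⟨fun a b c => hinj ?_, fun c a b hab => hinj ?_, fun m hm hop a => ?_⟩
  · apply ((hq b).mul (hq c)).mul_left_cancel
    calc q b * q c * h (op c (op b a))
        = h a * (q b * q c) := by rw [mul_assoc, rel2, ← mul_assoc, rel2, mul_assoc]
      _ = h a * (q c * q (op c b)) := by rw [rel1]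
      _ = q c * q (op c b) * h (op (op c b) (op c a)) := by
          rw [mul_assoc, rel2, ← mul_assoc, ← mul_assoc, rel2]
      _ = q b * q c * h (op (op c b) (op c a)) := by rw [rel1 b c]
  · apply (hq c).mul_right_cancel
    rw [← rel2, ← rel2]
    exact congrArg (fun x => q c * h x) hab
  · exact (hm a a (op a a) (hop a a)).symm
end

section
/- Let (X,+,∘) be a skew brace and f: X → X a bijection such that f(a − b + c) = f(a) − f(b) + f(c) and f(a ∘ b) = a ∘ f(b) − a + f(a) for all a,b,c ∈ X. Define σ_a(b) := −f(a) + a ∘ b and τ_b(a) := (σ_a(b))^{-1} ∘ a ∘ b, where the inverse is taken with respect to ∘. Then the map r: X × X → X × X defined by r(a,b) = (σ_a(b), τ_b(a)) is a solution of the set-theoretic braid equation; in particular σ_a(σ_b(c)) = σ_{a∘b}(c) for all a,b,c ∈ X. -/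
/-- Let `(X,+,∘)` be a skew brace (the `∘`-group structure is given by `circ`
and `cinv`, with identity coinciding with `0`), and let `f : X → X` be a
bijection which is a heap endomorphism of `(X,+)` and satisfies
`f(a∘b) = a∘f(b) − a + f(a)`.  With `σ_a(b) := −f(a) + a∘b` and
`τ_b(a) := (σ_a(b))⁻¹ ∘ a ∘ b`, the map `r(a,b) = (σ_a(b), τ_b(a))` is a
solution of the set-theoretic braid equation; in particular
`σ_a(σ_b(c)) = σ_{a∘b}(c)`. -/
theorem twisted_skew_brace_solution {X : Type*} [AddGroup X]
    (circ : X → X → X) (cinv : X → X)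
    (hassoc : ∀ a b c : X, circ (circ a b) c = circ a (circ b c))
    (hzero_left : ∀ a : X, circ 0 a = a)
    (hzero_right : ∀ a : X, circ a 0 = a)
    (hcinv_left : ∀ a : X, circ (cinv a) a = 0)
    (hcinv_right : ∀ a : X, circ a (cinv a) = 0)
    (hdist_left : ∀ a b c : X, circ a (b + c) = circ a b - a + circ a c)
    (hdist_right : ∀ a b c : X, circ (b + c) a = circ b a - a + circ c a)
    (f : X → X) (hfbij : Function.Bijective f)
    (hheap : ∀ a b c : X, f (a - b + c) = f a - f b + f c)
    (hcond : ∀ a b : X, f (circ a b) = circ a (f b) - a + f a)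
    (σ τ : X → X → X)
    (hσ : ∀ a b : X, σ a b = -f a + circ a b)
    (hτ : ∀ a b : X, τ b a = circ (circ (cinv (σ a b)) a) b) :
    IsBraidSolution (fun p : X × X => (σ p.1 p.2, τ p.2 p.1)) ∧
    (∀ a b c : X, σ a (σ b c) = σ (circ a b) c) := by
  have hcancel : ∀ a x y : X, circ a x = circ a y → x = y := fun a x y h => by
    have h' := congrArg (circ (cinv a)) h
    simpa only [← hassoc, hcinv_left, hzero_left] using h'
  have hneg_add : ∀ a x y : X, circ a (-x + y) = a - circ a x + circ a y := fun a x y => by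
    have h := hdist_left a x (-x + y)
    rw [add_neg_cancel_left] at h
    rw [h]
    simp [sub_eq_add_neg, add_assoc]
  have hact : ∀ a b c : X, σ a (σ b c) = σ (circ a b) c := fun a b c => by
    rw [hσ a, hσ b, hσ, hneg_add, hcond, hassoc]
    simp [sub_eq_add_neg, add_assoc]
  have hprod : ∀ a b : X, circ (σ a b) (τ b a) = circ a b := fun a b => by
    rw [hτ, ← hassoc, ← hassoc, hcinv_right, hzero_left]
  -- The product of the first two output components depends only on `a` and `a ∘ b ∘ c`.
  have hpair : ∀ a b c : X,
      circ (σ a b) (σ (τ b a) c) = f 0 - f (f a) + circ a (circ b c) := fun a b c => by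
    have hf : f (σ a b) = f 0 - f (f a) + f (circ a b) := by
      rw [← hheap, hσ, zero_sub]
    have hc : circ (σ a b) (f (τ b a)) = f (circ a b) - f (σ a b) + σ a b := by
      rw [← hprod a b, hcond]
      simp [sub_eq_add_neg, add_assoc]
    rw [hσ (τ b a) c, hneg_add, hc, ← hassoc, hprod, hf, hassoc]
    simp [sub_eq_add_neg, add_assoc]
  refine ⟨?_, hact⟩
  funext ⟨a, b, c⟩
  have hfst : σ (σ a b) (σ (τ b a) c) = σ a (σ b c) := by
    rw [hact, hact, hprod]
  have hsnd : τ (σ (τ b a) c) (σ a b) = σ (τ (σ b c) a) (τ c b) := by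
    apply hcancel (σ a (σ b c))
    rw [hpair a (σ b c), hprod, ← hpair a b c, ← hfst, hprod]
  have htrd : τ c (τ b a) = τ (τ c b) (τ (σ b c) a) := by
    apply hcancel (circ (σ a b) (σ (τ b a) c))
    rw [hassoc, hprod, ← hassoc, hprod, hpair, ← hprod b c, ← hpair, hassoc, hassoc,
      hprod, ← hassoc (σ a (σ b c)), hprod, hassoc, hprod]
  simp only [braidMapL, braidMapR, Function.comp_apply, hfst, hsnd, htrd]
end
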